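/- arXiv:2311.15221 — 2 statements merged into one kernel-verified Lean document; each statement's English description precedes it below -/
import Mathlib

section
/- There exist absolute constants C, c > 0 such that whenever n, d ≥ C, setting γ_{n,d} = C √((log n)/d), with probability at least 1 − C e^{−c √d} − C e^{−c log n} over the draw of x_1, …, x_n, one has min over w ∈ R^d with 0 < ‖w − w*‖ ≤ γ_{n,d} of ⟨∇L(w), w − w*⟩ / ‖w − w*‖² ≤ −c (d log n)/n + C. -/
open MeasureTheory ProbabilityTheory Real

noncomputable section

/-- Euclidean inner product on `Fin d → ℝ`. -/
def dot {d : ℕ} (u v : Fin d → ℝ) : ℝ := ∑ j, u j * v j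

/-- Euclidean norm on `Fin d → ℝ`. -/
def nrm {d : ℕ} (u : Fin d → ℝ) : ℝ := Real.sqrt (∑ j, (u j) ^ 2)

/-- Standard Gaussian `N(0, I_d)` on `Fin d → ℝ`. -/
def stdGaussian (d : ℕ) : Measure (Fin d → ℝ) := Measure.pi fun _ => gaussianReal 0 1

/-- Law of `n` i.i.d. draws from `N(0, I_d)`. -/
def sample (n d : ℕ) : Measure (Fin n → Fin d → ℝ) := Measure.pi fun _ => stdGaussian d

/-- `⟨∇L(w), w - w*⟩` where `∇L(w) = (1/n) Σ ((w^⊤x_i)² - (w*^⊤x_i)²)(w^⊤x_i) x_i`. -/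
def gradDot {n d : ℕ} (wstar w : Fin d → ℝ) (x : Fin n → Fin d → ℝ) : ℝ :=
  (1 / n) * ∑ i,
    ((dot w (x i)) ^ 2 - (dot wstar (x i)) ^ 2) * (dot w (x i)) * (dot (w - wstar) (x i))

instance instProbStd (d : ℕ) : IsProbabilityMeasure (_root_.stdGaussian d) := by
  unfold _root_.stdGaussian; infer_instance

instance instProbSample (n d : ℕ) : IsProbabilityMeasure (sample n d) := by
  unfold sample; infer_instance

lemma measurable_dot {d : ℕ} (v : Fin d → ℝ) : Measurable (dot v) := by
  unfold dot; fun_prop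

lemma nrm_sq {d : ℕ} (v : Fin d → ℝ) : nrm v ^ 2 = dot v v := by
  unfold nrm dot
  rw [Real.sq_sqrt (Finset.sum_nonneg fun i _ => sq_nonneg _)]
  simp [sq]

lemma nrm_nonneg {d : ℕ} (v : Fin d → ℝ) : 0 ≤ nrm v := Real.sqrt_nonneg _

/-- A unit linear functional of a standard Gaussian vector is standard Gaussian. -/
lemma map_dot {d : ℕ} (v : Fin d → ℝ) (hv : nrm v = 1) :
    (_root_.stdGaussian d).map (dot v) = gaussianReal 0 1 := by
  have hm := measurable_dot v
  have : IsProbabilityMeasure ((_root_.stdGaussian d).map (dot v)) :=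
    Measure.isProbabilityMeasure_map hm.aemeasurable
  apply Measure.ext_of_charFun
  ext t
  rw [charFun_apply_real, integral_map hm.aemeasurable (by fun_prop), charFun_gaussianReal]
  have h1 : ∀ x : Fin d → ℝ, Complex.exp (↑t * ↑(dot v x) * Complex.I)
      = ∏ j, Complex.exp (((t * v j : ℝ) : ℂ) * ↑(x j) * Complex.I) := by
    intro x
    rw [← Complex.exp_sum]
    congr 1
    unfold dot
    push_cast
    rw [Finset.mul_sum, Finset.sum_mul]
    exact Finset.sum_congr rfl fun j _ => by ring
  simp_rw [h1]
  unfold _root_.stdGaussian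
  rw [integral_fintype_prod_eq_prod
    (f := fun j (y : ℝ) => Complex.exp (((t * v j : ℝ) : ℂ) * (y : ℂ) * Complex.I))]
  simp_rw [← charFun_apply_real, charFun_gaussianReal]
  rw [← Complex.exp_sum]
  congr 1
  have h2 : (∑ j, v j ^ 2 : ℝ) = 1 := by
    have := nrm_sq v
    rw [hv] at this
    simp only [dot, ← sq] at this
    linarith
  have h3 : ((∑ j, v j ^ 2 : ℝ) : ℂ) = 1 := by rw [h2]; simp
  push_cast at h3
  have h4 : ∀ j : Fin d, ((t * v j : ℝ) : ℂ) * ((0:ℝ):ℂ) * Complex.I - ((1 : NNReal) : ℂ) * ((t * v j : ℝ) : ℂ) ^ 2 / 2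
      = - ((t:ℂ) ^ 2 / 2) * (v j : ℂ) ^ 2 := by
    intro j; push_cast; simp; ring
  simp_rw [h4, ← Finset.mul_sum, h3]
  simp

/-- Chernoff bound for the squared norm of a standard Gaussian vector. -/
lemma norm_lower : ∃ κ > (0:ℝ), ∀ d : ℕ,
    (_root_.stdGaussian d).real {x | dot x x ≤ κ * d} ≤ Real.exp (-(κ * d)) := by
  set q : ℝ := ∫ y, Real.exp (-(y ^ 2)) ∂(gaussianReal 0 1) with hq
  have hint : Integrable (fun y : ℝ => Real.exp (-(y ^ 2))) (gaussianReal 0 1) := by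
    refine Integrable.of_bound (by fun_prop) 1 (ae_of_all _ fun y => ?_)
    rw [Real.norm_eq_abs, abs_of_pos (Real.exp_pos _)]
    exact Real.exp_le_one_iff.2 (by nlinarith [sq_nonneg y])
  have hq0 : 0 < q := integral_exp_pos hint
  have hq1 : q < 1 := by
    have h0 : 0 < ∫ y, (1 - Real.exp (-(y ^ 2))) ∂(gaussianReal 0 1) := by
      rw [integral_pos_iff_support_of_nonneg]
      · have : (Function.support fun y : ℝ => 1 - Real.exp (-(y ^ 2))) = {0}ᶜ := by
          ext y
          rw [Function.mem_support, ne_eq, sub_eq_zero, eq_comm, Real.exp_eq_one_iff]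
          simp
        rw [this, prob_compl_eq_one_sub (measurableSet_singleton _)]
        have h0 : (gaussianReal 0 1) {(0:ℝ)} = 0 := by
          have := nullSingletonClass_gaussianReal (μ := 0) (v := 1) (by simp)
          exact measure_singleton 0
        rw [h0]; simp
      · intro y
        simp only [Pi.zero_apply, sub_nonneg]
        exact Real.exp_le_one_iff.2 (by nlinarith [sq_nonneg y])
      · exact (integrable_const _).sub hint
    rw [integral_sub (integrable_const _) hint] at h0
    simp at h0
    linarith
  have hlog : Real.log q < 0 := Real.log_neg hq0 hq1
  refine ⟨-Real.log q / 2, by linarith, fun d => ?_⟩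
  set κ := -Real.log q / 2 with hκ
  have hE : ∫ x, Real.exp (-(dot x x)) ∂(_root_.stdGaussian d) = q ^ d := by
    have h1 : ∀ x : Fin d → ℝ, Real.exp (-(dot x x)) = ∏ j, Real.exp (-((x j) ^ 2)) := by
      intro x
      rw [← Real.exp_sum]; simp [dot, sq]
    simp_rw [h1]
    unfold _root_.stdGaussian
    rw [integral_fintype_prod_eq_prod (f := fun _ y => Real.exp (-(y ^ 2)))]
    simp [hq]
  have hm : Measurable fun x : Fin d → ℝ => dot x x := by unfold dot; fun_prop
  have hmk := mul_meas_ge_le_integral_of_nonneg (μ := _root_.stdGaussian d)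
    (f := fun x => Real.exp (-(dot x x))) (ae_of_all _ fun x => (Real.exp_pos _).le)
    (by
      refine Integrable.of_bound hm.neg.exp.aestronglyMeasurable 1 (ae_of_all _ fun y => ?_)
      rw [Real.norm_eq_abs, abs_of_pos (Real.exp_pos _)]
      refine Real.exp_le_one_iff.2 ?_
      rw [← nrm_sq]; nlinarith [sq_nonneg (nrm y)])
    (Real.exp (-(κ * d)))
  rw [hE] at hmk
  have hset : {x : Fin d → ℝ | dot x x ≤ κ * d} =
      {x | Real.exp (-(κ * d)) ≤ Real.exp (-(dot x x))} := by
    ext x; simp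
  rw [hset]
  have hqd : q ^ d = Real.exp (-(κ * d)) * Real.exp (-(κ * d)) := by
    rw [← Real.exp_add, ← Real.exp_log (pow_pos hq0 d), Real.log_pow]
    congr 1
    rw [hκ]; ring
  rw [hqd] at hmk
  exact le_of_mul_le_mul_left hmk (Real.exp_pos _)

/-- Chebyshev bound for sums of fourth powers. -/
lemma fourth : ∃ K > (0:ℝ), ∃ V > (0:ℝ), ∀ (d m N : ℕ) (v : Fin d → ℝ), nrm v = 1 → m ≤ N →
    0 < N → (sample m d).real {x | K * N ≤ ∑ j, (dot v (x j)) ^ 4} ≤ V / N := by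
  set f : ℝ → ℝ := fun y => y ^ 4 with hf
  have hfm : Measurable f := by fun_prop
  have hL : MemLp f 2 (gaussianReal 0 1) := by
    have h8 := memLp_id_gaussianReal (μ := 0) (v := 1) 8
    have h2 := h8.norm_rpow_div 4
    have h3 : MemLp (fun x : ℝ => ‖id x‖ ^ (4 : ENNReal).toReal) 2 (gaussianReal 0 1) := by
      convert! h2 using 1
      rw [ENNReal.eq_div_iff (by simp) (by simp)]
      norm_num
    refine (memLp_congr_norm hfm.aestronglyMeasurable h3.1 ?_).2 h3
    refine ae_of_all _ fun y => ?_
    simp [hf]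
  set M : ℝ := ∫ y, f y ∂(gaussianReal 0 1) with hM
  have hM0 : 0 ≤ M := integral_nonneg fun y => by simp only [hf, Pi.zero_apply]; positivity
  set W : ℝ := Var[f; gaussianReal 0 1] with hW
  have hW0 : 0 ≤ W := variance_nonneg _ _
  refine ⟨M + 1, by linarith, W + 1, by linarith, fun d m N v hv hmN hN => ?_⟩
  have hvm := measurable_dot v
  have hmap := map_dot v hv
  have hN' : (0:ℝ) < N := by exact_mod_cast hN
  have hmN' : (m:ℝ) ≤ N := by exact_mod_cast hmN
  have hL' : MemLp (fun y => f (dot v y)) 2 (_root_.stdGaussian d) := by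
    rw [← hmap] at hL
    exact (memLp_map_measure_iff (by fun_prop) hvm.aemeasurable).1 hL
  have hMd : ∫ y, f (dot v y) ∂(_root_.stdGaussian d) = M := by
    rw [hM, ← hmap, integral_map hvm.aemeasurable (by fun_prop)]
  have hWd : Var[fun y => f (dot v y); _root_.stdGaussian d] = W := by
    rw [hW, ← hmap, variance_map (by fun_prop) hvm.aemeasurable]
    rfl
  have hmp : ∀ j : Fin m, MeasurePreserving (fun x : Fin m → Fin d → ℝ => x j) (sample m d)
      (_root_.stdGaussian d) := fun j => measurePreserving_eval _ j
  set X : (Fin m → Fin d → ℝ) → ℝ := ∑ j, fun x => f (dot v (x j)) with hX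
  have hterm : ∀ j : Fin m, MemLp (fun x : Fin m → Fin d → ℝ => f (dot v (x j))) 2 (sample m d) :=
    fun j => hL'.comp_measurePreserving (hmp j)
  have hXL : MemLp X 2 (sample m d) := memLp_finsetSum' _ fun j _ => hterm j
  have hXv : Var[X; sample m d] = m * W := by
    rw [hX]
    unfold sample
    rw [variance_sum_pi (X := fun _ y => f (dot v y)) (fun _ => hL')]
    simp [hWd]
  have hXE : ∫ x, X x ∂(sample m d) = m * M := by
    rw [hX]
    simp only [Finset.sum_apply]
    rw [integral_finsetSum _ fun j _ => (hterm j).integrable (by norm_num)]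
    have : ∀ j : Fin m, ∫ x, f (dot v (x j)) ∂(sample m d) = M := by
      intro j
      rw [← hMd, ← (hmp j).map_eq, integral_map (hmp j).aemeasurable (by fun_prop)]
    simp [this]
  have hch := meas_ge_le_variance_div_sq hXL hN'
  rw [hXv, hXE] at hch
  have hsub : {x : Fin m → Fin d → ℝ | (M + 1) * N ≤ ∑ j, (dot v (x j)) ^ 4} ⊆
      {x | (N:ℝ) ≤ |X x - m * M|} := by
    intro x hx
    simp only [Set.mem_ofPred_eq] at hx ⊢
    refine le_trans ?_ (le_abs_self _)
    simp only [hX, Finset.sum_apply, hf]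
    nlinarith
  have h1 : (sample m d).real {x | (M + 1) * N ≤ ∑ j, (dot v (x j)) ^ 4} ≤ m * W / (N:ℝ) ^ 2 := by
    rw [measureReal_def]
    refine ENNReal.toReal_le_of_le_ofReal (by positivity) ((measure_mono hsub).trans hch)
  refine h1.trans ?_
  rw [div_le_div_iff₀ (by positivity) hN']
  have : (m:ℝ) * W ≤ N * (W + 1) := by nlinarith
  nlinarith

/-- Two-sided bounds for the Gaussian mass of `[t, t+1]`. -/
lemma gauss_Icc (t : ℝ) (ht : 0 ≤ t) :
    Real.exp (-(t + 1) ^ 2 / 2) / 4 ≤ (gaussianReal 0 1).real (Set.Icc t (t + 1)) ∧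
    (gaussianReal 0 1).real (Set.Icc t (t + 1)) ≤ Real.exp (-t ^ 2 / 2) := by
  have hpi : 1 ≤ √(2 * π) := by
    rw [Real.one_le_sqrt]; nlinarith [Real.pi_gt_three]
  have hpi4 : √(2 * π) ≤ 4 := by
    rw [Real.sqrt_le_left (by norm_num)]; nlinarith [Real.pi_lt_four]
  have hpdf : ∀ x, gaussianPDFReal 0 1 x = (√(2 * π))⁻¹ * Real.exp (-x ^ 2 / 2) := by
    intro x; simp [gaussianPDFReal]
  have hI : (gaussianReal 0 1).real (Set.Icc t (t + 1)) =
      ∫ x in Set.Icc t (t + 1), gaussianPDFReal 0 1 x := by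
    rw [measureReal_def, gaussianReal_apply_eq_integral _ (by simp), ENNReal.toReal_ofReal]
    exact integral_nonneg fun x => gaussianPDFReal_nonneg _ _ _
  have hint : IntegrableOn (gaussianPDFReal 0 1) (Set.Icc t (t + 1)) :=
    (integrable_gaussianPDFReal 0 1).integrableOn
  have hc : ∀ c : ℝ, ∫ x in Set.Icc t (t + 1), c = c := by intro c; simp
  rw [hI]
  constructor
  · rw [← hc (Real.exp (-(t + 1) ^ 2 / 2) / 4)]
    refine setIntegral_mono_on (by simp) hint measurableSet_Icc fun x hx => ?_
    rw [hpdf, div_eq_inv_mul]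
    have := hx.1
    have := hx.2
    gcongr
    nlinarith
  · rw [← hc (Real.exp (-t ^ 2 / 2))]
    refine setIntegral_mono_on hint (by simp) measurableSet_Icc fun x hx => ?_
    rw [hpdf]
    have := hx.1
    have h1 : (√(2 * π))⁻¹ ≤ 1 := inv_le_one_of_one_le₀ hpi
    have h2 : Real.exp (-x ^ 2 / 2) ≤ Real.exp (-t ^ 2 / 2) := by gcongr
    calc _ ≤ 1 * Real.exp (-x ^ 2 / 2) := by gcongr
      _ ≤ _ := by linarith

lemma dot_add_left {d : ℕ} (u v z : Fin d → ℝ) : dot (u + v) z = dot u z + dot v z := by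
  simp [dot, add_mul, Finset.sum_add_distrib]

lemma dot_sub_left {d : ℕ} (u v z : Fin d → ℝ) : dot (u - v) z = dot u z - dot v z := by
  simp [dot, sub_mul, Finset.sum_sub_distrib]

lemma dot_smul_left {d : ℕ} (r : ℝ) (v z : Fin d → ℝ) : dot (r • v) z = r * dot v z := by
  simp [dot, Finset.mul_sum, mul_assoc]

lemma dot_comm' {d : ℕ} (v z : Fin d → ℝ) : dot v z = dot z v := by
  simp [dot, mul_comm]

/-- The component of `x` orthogonal to `w`. -/
def perp {d : ℕ} (w x : Fin d → ℝ) : Fin d → ℝ := x - dot w x • w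

/-- The normalized component of `x` orthogonal to `w`. -/
def uperp {d : ℕ} (w x : Fin d → ℝ) : Fin d → ℝ := (nrm (perp w x))⁻¹ • perp w x

lemma dot_perp {d : ℕ} (w x : Fin d → ℝ) :
    dot (perp w x) x = dot x x - dot w x ^ 2 := by
  unfold perp
  rw [dot_sub_left, dot_smul_left]; ring

lemma dot_perp_perp {d : ℕ} (w x : Fin d → ℝ) (hw : nrm w = 1) :
    dot (perp w x) (perp w x) = dot x x - dot w x ^ 2 := by
  have h1 : dot w w = 1 := by rw [← nrm_sq, hw]; norm_num
  have h2 : dot (perp w x) w = 0 := by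
    unfold perp
    rw [dot_sub_left, dot_smul_left, h1, dot_comm' x w]; ring
  have h3 : dot (perp w x) (perp w x) = dot (perp w x) x := by
    nth_rewrite 1 [perp]
    rw [dot_sub_left, dot_smul_left, dot_comm' w (perp w x), h2, dot_comm' x]; ring
  rw [h3, dot_perp w x]

lemma measurable_perp {d : ℕ} (w : Fin d → ℝ) : Measurable (perp w) := by
  have := measurable_dot w
  unfold perp
  fun_prop

lemma measurable_uperp {d : ℕ} (w : Fin d → ℝ) : Measurable (uperp w) := by
  have h := measurable_perp w
  have h2 : Measurable (nrm : (Fin d → ℝ) → ℝ) := by unfold nrm; fun_prop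
  have h3 : Measurable fun x => nrm (perp w x) := h2.comp h
  unfold uperp
  fun_prop

lemma nrm_smul {d : ℕ} (r : ℝ) (v : Fin d → ℝ) : nrm (r • v) = |r| * nrm v := by
  have h : nrm (r • v) ^ 2 = (|r| * nrm v) ^ 2 := by
    rw [nrm_sq, dot_smul_left, dot_comm', dot_smul_left, mul_pow, sq_abs, nrm_sq]; ring
  exact (sq_eq_sq₀ (nrm_nonneg _) (mul_nonneg (abs_nonneg _) (nrm_nonneg _))).1 h

lemma uperp_cases {d : ℕ} (w x : Fin d → ℝ) : nrm (uperp w x) = 1 ∨ uperp w x = 0 := by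
  by_cases h : nrm (perp w x) = 0
  · right; simp [uperp, h]
  · left
    unfold uperp
    rw [nrm_smul, abs_of_nonneg (inv_nonneg.2 (nrm_nonneg _)), inv_mul_cancel₀ h]

/-- Deterministic part, easy regime. -/
lemma det_easy {n d : ℕ} (hn : 0 < n) (wstar : Fin d → ℝ) (hw : nrm wstar = 1)
    (x : Fin n → Fin d → ℝ) (K s : ℝ) (hs : 0 < s) (hs1 : s ≤ 1)
    (ha : ∑ j, (dot wstar (x j)) ^ 4 ≤ K * n) :
    ∃ w : Fin d → ℝ, nrm (w - wstar) = s ∧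
      gradDot wstar w x / (nrm (w - wstar)) ^ 2 ≤ 6 * K := by
  have hn' : (0:ℝ) < n := by exact_mod_cast hn
  refine ⟨wstar + s • wstar, ?_, ?_⟩
  · rw [add_sub_cancel_left, nrm_smul, hw, abs_of_pos hs, mul_one]
  · rw [add_sub_cancel_left, nrm_smul, hw, abs_of_pos hs, mul_one]
    unfold gradDot
    simp only [add_sub_cancel_left, dot_add_left, dot_smul_left]
    have h1 : ∑ i, ((dot wstar (x i) + s * dot wstar (x i)) ^ 2 - dot wstar (x i) ^ 2) *
        (dot wstar (x i) + s * dot wstar (x i)) * (s * dot wstar (x i))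
        = s ^ 2 * ((2 + s) * (1 + s) * ∑ i, (dot wstar (x i)) ^ 4) := by
      rw [Finset.mul_sum, Finset.mul_sum]
      exact Finset.sum_congr rfl fun i _ => by ring
    rw [h1]
    have h0 : 0 ≤ ∑ i, (dot wstar (x i)) ^ 4 := Finset.sum_nonneg fun i _ => by positivity
    have h2 : (2 + s) * (1 + s) * ∑ i, (dot wstar (x i)) ^ 4 ≤ 6 * (K * n) := by
      have : (2 + s) * (1 + s) ≤ 6 := by nlinarith
      nlinarith
    have h3 : 1 / (n:ℝ) * (s ^ 2 * ((2 + s) * (1 + s) * ∑ i, (dot wstar (x i)) ^ 4)) / s ^ 2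
        = ((2 + s) * (1 + s) * ∑ i, (dot wstar (x i)) ^ 4) / n := by
      field_simp
    rw [h3, div_le_iff₀ hn']
    linarith

lemma poly_bound (a g δ : ℝ) (h0 : 0 ≤ δ) (h1 : δ ≤ 1) :
    ((a + -δ * g) ^ 2 - a ^ 2) * (a + -δ * g) * (-δ * g) ≤ δ ^ 2 * (5 * (a ^ 4 + g ^ 4)) := by
  have e : ((a + -δ * g) ^ 2 - a ^ 2) * (a + -δ * g) * (-δ * g)
      = δ ^ 2 * (2 * a ^ 2 * g ^ 2 - 3 * δ * a * g ^ 3 + δ ^ 2 * g ^ 4) := by ring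
  rw [e]
  refine mul_le_mul_of_nonneg_left ?_ (sq_nonneg _)
  have h2 : δ ^ 2 ≤ 1 := by nlinarith
  have h3 : δ ^ 2 * g ^ 4 ≤ g ^ 4 := by nlinarith [sq_nonneg (g ^ 2)]
  have h4 : -(3 * δ * a * g ^ 3) ≤ 3 / 2 * (a ^ 2 * g ^ 2 + δ ^ 2 * g ^ 4) := by
    nlinarith [sq_nonneg (a * g + δ * g ^ 2)]
  nlinarith [sq_nonneg (a ^ 2 - g ^ 2), sq_nonneg (a ^ 2), sq_nonneg (g ^ 2)]

/-- Deterministic part, hard regime. -/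
lemma det_hard {m d : ℕ} (wstar : Fin d → ℝ) (hw : nrm wstar = 1)
    (x : Fin (m + 1) → Fin d → ℝ) (i : Fin (m + 1)) (K t Y : ℝ) (ht : 4 ≤ t)
    (hY : Y = dot (x i) (x i) - dot wstar (x i) ^ 2) (htY : 4 * t ^ 2 ≤ Y)
    (hai : dot wstar (x i) ∈ Set.Icc t (t + 1))
    (ha : ∑ j, (dot wstar (x j)) ^ 4 ≤ K * (m + 1 : ℕ))
    (hg : ∑ j, (dot (uperp wstar (x i)) (x (i.succAbove j))) ^ 4 ≤ K * (m + 1 : ℕ)) :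
    ∃ w : Fin d → ℝ, nrm (w - wstar) = (3 * t / 2) / √Y ∧
      gradDot wstar w x / (nrm (w - wstar)) ^ 2 ≤ -(Y * t ^ 2 / 8) / (m + 1 : ℕ) + 10 * K := by
  set N : ℝ := ((m + 1 : ℕ) : ℝ) with hN
  have hN0 : 0 < N := by rw [hN]; positivity
  have hY0 : 0 < Y := by nlinarith
  set s := √Y with hs
  have hs0 : 0 < s := Real.sqrt_pos.2 hY0
  have hss : s ^ 2 = Y := Real.sq_sqrt hY0.le
  have hns : nrm (perp wstar (x i)) = s := by
    rw [hs, hY, ← dot_perp_perp wstar _ hw, ← nrm_sq, Real.sqrt_sq (nrm_nonneg _)]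
  set δ := (3 * t / 2) / s with hδ
  have hδ0 : 0 < δ := by positivity
  have hδ1 : δ ≤ 1 := by
    rw [hδ, div_le_one hs0]
    refine le_of_sq_le_sq ?_ hs0.le
    rw [hss]; nlinarith
  have hδs : δ * s = 3 * t / 2 := by rw [hδ]; field_simp
  have hperp : ∀ z, dot (perp wstar (x i)) z = s * dot (uperp wstar (x i)) z := by
    intro z
    unfold uperp
    rw [dot_smul_left, hns]; field_simp
  have hv1 : nrm (uperp wstar (x i)) = 1 := by
    unfold uperp
    rw [nrm_smul, hns, abs_of_pos (inv_pos.2 hs0), inv_mul_cancel₀ hs0.ne']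
  have hvi : dot (uperp wstar (x i)) (x i) = s := by
    have h1 := hperp (x i)
    rw [dot_perp _ _, ← hY, ← hss, sq] at h1
    exact (mul_left_cancel₀ hs0.ne' h1).symm
  have hnu : nrm (-δ • uperp wstar (x i)) = δ := by
    rw [nrm_smul, hv1, abs_neg, abs_of_pos hδ0, mul_one]
  refine ⟨wstar + -δ • uperp wstar (x i), ?_, ?_⟩
  · rw [add_sub_cancel_left, hnu]
  · rw [add_sub_cancel_left, hnu]
    unfold gradDot
    simp only [add_sub_cancel_left, dot_add_left, dot_smul_left]
    rw [Fin.sum_univ_succAbove _ i, hvi]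
    rw [Fin.sum_univ_succAbove _ i] at ha
    set a := dot wstar (x i) with haa
    have hA : ((a + -δ * s) ^ 2 - a ^ 2) * (a + -δ * s) * (-δ * s) ≤ δ ^ 2 * -(Y * t ^ 2 / 8) := by
      have e1 : -δ * s = -(3 * t / 2) := by rw [neg_mul, hδs]
      have e2 : δ ^ 2 * -(Y * t ^ 2 / 8) = - ((3 * t / 2) ^ 2 * (t ^ 2 / 8)) := by
        rw [← hδs, ← hss]; ring
      rw [e1, e2]
      have e3 : ((a + -(3 * t / 2)) ^ 2 - a ^ 2) * (a + -(3 * t / 2)) * -(3 * t / 2)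
        = - ((3 * t / 2) ^ 2 * ((2 * a - 3 * t / 2) * (3 * t / 2 - a))) := by ring
      rw [e3]
      have h5 := hai.1
      have h6 := hai.2
      have h7 : t ^ 2 / 8 ≤ (2 * a - 3 * t / 2) * (3 * t / 2 - a) := by
        calc t ^ 2 / 8 = (t / 2) * (t / 4) := by ring
          _ ≤ _ := by
            apply mul_le_mul <;> linarith
      have := mul_le_mul_of_nonneg_left h7 (sq_nonneg (3 * t / 2))
      linarith
    have hB : ∑ j : Fin m, ((dot wstar (x (i.succAbove j)) +
          -δ * dot (uperp wstar (x i)) (x (i.succAbove j))) ^ 2 -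
          dot wstar (x (i.succAbove j)) ^ 2) *
        (dot wstar (x (i.succAbove j)) + -δ * dot (uperp wstar (x i)) (x (i.succAbove j))) *
        (-δ * dot (uperp wstar (x i)) (x (i.succAbove j))) ≤ δ ^ 2 * (10 * (K * N)) := by
      refine (Finset.sum_le_sum fun j _ => poly_bound _ _ δ hδ0.le hδ1).trans ?_
      rw [← Finset.mul_sum, ← Finset.mul_sum, Finset.sum_add_distrib]
      refine mul_le_mul_of_nonneg_left ?_ (sq_nonneg _)
      have : 0 ≤ a ^ 4 := by positivity
      linarith
    rw [div_le_iff₀ (by positivity)]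
    calc _ ≤ 1 / N * (δ ^ 2 * -(Y * t ^ 2 / 8) + δ ^ 2 * (10 * (K * N))) := by
            gcongr
      _ = _ := by field_simp

/-- Probability that no index has `⟨w, x_i⟩ ∈ [t, t+1]`. -/
lemma prob_no_index {n d : ℕ} (w : Fin d → ℝ) (I : Set ℝ) (hI : MeasurableSet I) (hw : nrm w = 1) :
    (sample n d).real {x | ∀ i, dot w (x i) ∉ I} ≤
      Real.exp (-(n * (gaussianReal 0 1).real I)) := by
  have hm := measurable_dot w
  have hset : {x : Fin n → Fin d → ℝ | ∀ i, dot w (x i) ∉ I} =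
      Set.pi Set.univ (fun _ => dot w ⁻¹' Iᶜ) := by
    ext x; simp
  have h1 : (_root_.stdGaussian d).real (dot w ⁻¹' Iᶜ) = 1 - (gaussianReal 0 1).real I := by
    rw [← map_measureReal_apply hm hI.compl, map_dot w hw, probReal_compl_eq_one_sub hI]
  rw [hset, measureReal_def]
  unfold sample
  rw [Measure.pi_pi, ENNReal.toReal_prod]
  simp only [Finset.prod_const, Finset.card_univ, Fintype.card_fin]
  rw [← measureReal_def, h1]
  calc (1 - (gaussianReal 0 1).real I) ^ n ≤ (Real.exp (-(gaussianReal 0 1).real I)) ^ n := by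
        gcongr
        · linarith [measureReal_le_one (μ := gaussianReal 0 1) (s := I)]
        · exact Real.one_sub_le_exp_neg _
    _ = _ := by rw [← Real.exp_nat_mul]; ring_nf

/-- Conditioning on one of the samples. -/
lemma cond_one {m d : ℕ} (i : Fin (m + 1)) (T : Set (Fin d → ℝ)) (hT : MeasurableSet T)
    (v : (Fin d → ℝ) → (Fin d → ℝ)) (hv : Measurable v) (R b : ℝ) (hb : 0 ≤ b)
    (h : ∀ y, (sample m d).real {z | R ≤ ∑ j, (dot (v y) (z j)) ^ 4} ≤ b) :
    (sample (m + 1) d).real {x | x i ∈ T ∧ R ≤ ∑ j, (dot (v (x i)) (x (i.succAbove j))) ^ 4} ≤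
      (_root_.stdGaussian d).real T * b := by
  have hmp := measurePreserving_piFinSuccAbove (fun _ : Fin (m + 1) => _root_.stdGaussian d) i
  set S : Set ((Fin d → ℝ) × (Fin m → Fin d → ℝ)) :=
    {p | p.1 ∈ T ∧ R ≤ ∑ j, (dot (v p.1) (p.2 j)) ^ 4} with hS
  have hSm : MeasurableSet S := by
    have hf : Measurable fun p : (Fin d → ℝ) × (Fin m → Fin d → ℝ) =>
        ∑ j, (dot (v p.1) (p.2 j)) ^ 4 := by
      unfold dot
      fun_prop
    exact (measurable_fst hT).inter (measurableSet_le measurable_const hf)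
  have hset : {x : Fin (m + 1) → Fin d → ℝ |
      x i ∈ T ∧ R ≤ ∑ j, (dot (v (x i)) (x (i.succAbove j))) ^ 4} =
      (MeasurableEquiv.piFinSuccAbove (fun _ => Fin d → ℝ) i) ⁻¹' S := by
    ext x; rfl
  have hle : (sample (m + 1) d) {x | x i ∈ T ∧ R ≤ ∑ j, (dot (v (x i)) (x (i.succAbove j))) ^ 4} ≤
      (_root_.stdGaussian d) T * ENNReal.ofReal b := by
    rw [hset]
    have : (sample (m + 1) d) ((MeasurableEquiv.piFinSuccAbove (fun _ => Fin d → ℝ) i) ⁻¹' S) =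
        ((_root_.stdGaussian d).prod (sample m d)) S := hmp.measure_preimage hSm.nullMeasurableSet
    rw [this, Measure.prod_apply hSm]
    calc _ ≤ ∫⁻ y, T.indicator (fun _ => ENNReal.ofReal b) y ∂(_root_.stdGaussian d) := by
          refine lintegral_mono fun y => ?_
          by_cases hy : y ∈ T
          · rw [Set.indicator_of_mem hy, ENNReal.le_ofReal_iff_toReal_le (by simp) hb]
            refine le_trans ?_ (h y)
            refine measureReal_mono ?_
            intro z hz
            exact hz.2
          · have : Prod.mk y ⁻¹' S = ∅ := by
              ext z; simp [hS, hy]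
            rw [this]; simp
      _ = _ := by rw [lintegral_indicator_const hT, mul_comm]
  rw [measureReal_def, measureReal_def]
  calc _ ≤ ((_root_.stdGaussian d) T * ENNReal.ofReal b).toReal :=
        ENNReal.toReal_mono (by finiteness) hle
    _ = _ := by rw [ENNReal.toReal_mul, ENNReal.toReal_ofReal hb]

lemma one_sub_le_of_compl {Ω : Type*} [MeasurableSpace Ω] (μ : Measure Ω) [IsProbabilityMeasure μ]
    (S B : Set Ω) (h : ∀ x, x ∉ B → x ∈ S) : 1 - μ.real B ≤ μ.real S := by
  have h1 : μ.real (B ∪ S) = 1 := by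
    have : B ∪ S = Set.univ := by
      ext x
      by_cases hx : x ∈ B
      · simp [hx]
      · simp [h x hx]
    rw [this]; simp
  have := measureReal_union_le (μ := μ) B S
  linarith

lemma num_log (n : ℝ) (hn : 1 ≤ n) : Real.log n ^ 2 ≤ 16 * √n := by
  have h0 : 0 < n := by linarith
  have h1 : 0 < √(√n) := by positivity
  have h2 : Real.log n = 4 * Real.log (√(√n)) := by
    rw [Real.log_sqrt (by positivity), Real.log_sqrt h0.le]; ring
  have h3 : Real.log (√(√n)) ≤ √(√n) := by
    have := Real.log_le_sub_one_of_pos h1; linarith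
  have h4 : 0 ≤ Real.log (√(√n)) := by
    have := Real.log_nonneg hn
    linarith
  rw [h2, mul_pow]
  have h5 : Real.log (√(√n)) ^ 2 ≤ √(√n) ^ 2 := by gcongr
  rw [Real.sq_sqrt (Real.sqrt_nonneg _)] at h5
  linarith

/-- In the hard regime `log n` is small compared to `d`. -/
lemma num_d (n d κ : ℝ) (hκ : 0 < κ) (hn : 1 < n) (hd : 0 < d) (hC : (64 / κ) ^ 2 ≤ n)
    (h : n < d * Real.log n) : Real.log n ≤ κ * d / 4 := by
  have hL : 0 < Real.log n := Real.log_pos hn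
  have h1 := num_log n hn.le
  have hn0 : 0 ≤ n := by linarith
  have h2 : 64 / κ ≤ √n := Real.le_sqrt_of_sq_le hC
  rw [div_le_iff₀ hκ] at h2
  have h3 : √n * √n = n := Real.mul_self_sqrt hn0
  have h4 : 0 < √n := Real.sqrt_pos.2 (by linarith)
  -- `log² n ≤ 16 √n ≤ (κ / 4) n`
  have h5 : Real.log n ^ 2 ≤ κ / 4 * n := by nlinarith
  have h6 : Real.log n * Real.log n ≤ (κ * d / 4) * Real.log n := by nlinarith
  exact le_of_mul_le_mul_right h6 hL

lemma num_exp (n d κ : ℝ) (hκ : 0 < κ) (hn : 1 < n) (hd : 0 < d)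
    (h : n < d * Real.log n) : n * Real.exp (-(κ * d)) ≤ 384 / κ ^ 4 / n := by
  have hn0 : 0 < n := by linarith
  have h3 : √n * √n = n := Real.mul_self_sqrt hn0.le
  have h4 : 0 < √n := Real.sqrt_pos.2 (by linarith)
  have h5 : Real.log n ≤ 2 * √n := by
    have h6 : Real.log n = 2 * Real.log (√n) := by rw [Real.log_sqrt hn0.le]; ring
    have := Real.log_le_sub_one_of_pos h4
    linarith
  have h6 : √n ≤ 2 * d := by
    have : √n * √n ≤ (2 * d) * √n := by nlinarith
    exact le_of_mul_le_mul_right this h4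
  have h7 : n ≤ 4 * d ^ 2 := by nlinarith
  have h8 : n ^ 2 ≤ 16 * d ^ 4 := by nlinarith
  have h9 := Real.pow_div_factorial_le_exp (x := κ * d) (by positivity) 4
  have h10 : (κ * d) ^ 4 ≤ 24 * Real.exp (κ * d) := by
    rw [div_le_iff₀ (by positivity)] at h9
    norm_num [Nat.factorial] at h9
    linarith
  rw [Real.exp_neg, le_div_iff₀ hn0, le_div_iff₀ (by positivity)]
  rw [← div_eq_mul_inv, div_mul_eq_mul_div, div_mul_eq_mul_div, div_le_iff₀ (Real.exp_pos _)]
  calc n * n * κ ^ 4 = n ^ 2 * κ ^ 4 := by ring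
    _ ≤ 16 * d ^ 4 * κ ^ 4 := by gcongr
    _ = 16 * (κ * d) ^ 4 := by ring
    _ ≤ _ := by linarith

lemma num_noidx (n t p : ℝ) (hn : 1 < n) (ht : t ^ 2 = Real.log n / 2)
    (hp : Real.exp (-(t + 1) ^ 2 / 2) / 4 ≤ p) :
    Real.exp (-(n * p)) ≤ 12 * Real.exp (-(Real.log n / 4)) := by
  have hn0 : 0 < n := by linarith
  have hL : 0 < Real.log n := Real.log_pos hn
  have h1 : Real.exp (-(Real.log n / 2) - 1) ≤ Real.exp (-(t + 1) ^ 2 / 2) := by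
    apply Real.exp_le_exp.2
    nlinarith [sq_nonneg (t - 1)]
  have h2 : Real.exp (Real.log n / 2 - 1) / 4 ≤ n * p := by
    calc Real.exp (Real.log n / 2 - 1) / 4
        = Real.exp (Real.log n) * (Real.exp (-(Real.log n / 2) - 1) / 4) := by
          rw [← mul_div_assoc, ← Real.exp_add]; ring_nf
      _ = n * (Real.exp (-(Real.log n / 2) - 1) / 4) := by rw [Real.exp_log hn0]
      _ ≤ n * p := by gcongr; linarith
  set y := Real.exp (Real.log n / 2 - 1) / 4 with hy
  have hy0 : 0 < y := by positivity
  have h3 : Real.exp (-(n * p)) ≤ 1 / y := by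
    calc Real.exp (-(n * p)) ≤ Real.exp (-y) := by gcongr
      _ = 1 / Real.exp y := by rw [Real.exp_neg, one_div]
      _ ≤ 1 / y := by
        gcongr
        have := Real.add_one_le_exp y
        linarith
  refine h3.trans ?_
  rw [hy, one_div_div, div_le_iff₀ (Real.exp_pos _), mul_assoc, ← Real.exp_add]
  have h4 : Real.exp (-1) ≤ Real.exp (-(Real.log n / 4) + (Real.log n / 2 - 1)) := by
    apply Real.exp_le_exp.2; linarith
  have h5 : 1 / 3 ≤ Real.exp (-1) := by
    rw [Real.exp_neg, ← one_div]
    have := Real.exp_one_lt_d9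
    gcongr
    linarith
  linarith

set_option maxHeartbeats 4000000 in
/-- **Theorem 3.3 (Negative Result)**: there exist absolute constants `C, c > 0` such that for
`n, d ≥ C`, with `γ_{n,d} = C √(log n / d)`, with probability at least
`1 - C e^{-c √d} - C e^{-c log n}`,
`min_{0 < ‖w - w*‖ ≤ γ_{n,d}} ⟨∇L(w), w - w*⟩ / ‖w - w*‖² ≤ -c (d log n)/n + C`. -/
theorem stmt4 :
    ∃ C > (0 : ℝ), ∃ c > (0 : ℝ),
      ∀ (n d : ℕ) (wstar : Fin d → ℝ),
        nrm wstar = 1 → C ≤ (n : ℝ) → C ≤ (d : ℝ) →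
        1 - C * Real.exp (-c * Real.sqrt d) - C * Real.exp (-c * Real.log n) ≤
          (sample n d {x | ∃ w : Fin d → ℝ,
              0 < nrm (w - wstar) ∧ nrm (w - wstar) ≤ C * Real.sqrt (Real.log n / d) ∧
              gradDot wstar w x / (nrm (w - wstar)) ^ 2 ≤
                -c * ((d : ℝ) * Real.log n) / n + C}).toReal := by
  obtain ⟨κ, hκ, hnorm⟩ := norm_lower
  obtain ⟨K, hK, V, hV, hfour⟩ := fourth
  set C : ℝ := Real.exp 32 + (64 / κ) ^ 2 + 384 / κ ^ 4 + 3 / κ + 10 * K + 2 * V + 12 + 1 with hC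
  have p1 : 0 < Real.exp 32 := Real.exp_pos _
  have p2 : 0 < (64 / κ) ^ 2 := by positivity
  have p3 : 0 < 384 / κ ^ 4 := by positivity
  have p4 : 0 < 3 / κ := by positivity
  have hC0 : 0 < C := by positivity
  set c : ℝ := min (1 / 4) (κ / 32) with hc
  have hc0 : 0 < c := by rw [hc]; positivity
  have hc1 : c ≤ 1 / 4 := min_le_left _ _
  have hc2 : c ≤ κ / 32 := min_le_right _ _
  refine ⟨C, hC0, c, hc0, fun n d wstar hw hCn hCd => ?_⟩
  have hn1 : (1:ℝ) < n := by linarith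
  have hn0 : (0:ℝ) < n := by linarith
  have hd0 : (0:ℝ) < d := by linarith
  have hnpos : 0 < n := by exact_mod_cast hn0
  set L := Real.log n with hL
  have hL32 : 32 ≤ L := by
    rw [hL, Real.le_log_iff_exp_le hn0]; linarith
  have hexpL : Real.exp L = n := Real.exp_log hn0
  set r := Real.exp (-(L / 4)) with hr
  have hr0 : 0 < r := Real.exp_pos _
  have hinv : 1 / (n:ℝ) ≤ r := by
    rw [← hexpL, one_div, ← Real.exp_neg, hr]
    apply Real.exp_le_exp.2; linarith
  have hCr : C * r ≤ C * Real.exp (-c * L) := by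
    gcongr
    rw [hr]; apply Real.exp_le_exp.2; nlinarith only [hc1, hL32]
  have hCe : 0 ≤ C * Real.exp (-c * √d) := by positivity
  change _ ≤ (sample n d).real _
  set S : Set (Fin n → Fin d → ℝ) := {x | ∃ w : Fin d → ℝ,
              0 < nrm (w - wstar) ∧ nrm (w - wstar) ≤ C * Real.sqrt (L / d) ∧
              gradDot wstar w x / (nrm (w - wstar)) ^ 2 ≤
                -c * ((d : ℝ) * L) / n + C} with hS
  suffices hB : ∃ B : Set (Fin n → Fin d → ℝ), (∀ x, x ∉ B → x ∈ S) ∧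
      (sample n d).real B ≤ C * r by
    obtain ⟨B, hB1, hB2⟩ := hB
    have := one_sub_le_of_compl (sample n d) S B hB1
    linarith
  set B1 : Set (Fin n → Fin d → ℝ) := {x | K * n ≤ ∑ j, (dot wstar (x j)) ^ 4} with hB1
  have hPB1 : (sample n d).real B1 ≤ V * r := by
    refine (hfour d n n wstar hw le_rfl hnpos).trans ?_
    rw [div_eq_mul_one_div]
    gcongr
  rcases le_or_gt ((d:ℝ) * L) n with hcase | hcase
  · refine ⟨B1, fun x hx => ?_, ?_⟩
    · have hx' : ∑ j, (dot wstar (x j)) ^ 4 ≤ K * n := by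
        by_contra hcon
        exact hx (not_le.1 hcon).le
      have hs : 0 < min 1 (C * √(L / d)) := by
        have : 0 < L / d := by positivity
        positivity
      obtain ⟨w, hw1, hw2⟩ := det_easy hnpos wstar hw x K _ hs (min_le_left _ _) hx'
      refine ⟨w, by rw [hw1]; exact hs, by rw [hw1]; exact min_le_right _ _, hw2.trans ?_⟩
      have h1 : (d:ℝ) * L / n ≤ 1 := (div_le_one hn0).2 hcase
      have h2 : -c * ((d : ℝ) * L) / n = -(c * ((d:ℝ) * L / n)) := by ring
      rw [h2]
      have h3 : c * ((d:ℝ) * L / n) ≤ c * 1 := mul_le_mul_of_nonneg_left h1 hc0.le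
      linarith
    · refine hPB1.trans ?_
      gcongr
      linarith
  · have hLd : L ≤ κ * d / 4 := num_d n d κ hκ hn1 hd0 (by linarith) hcase
    have hne := num_exp n d κ hκ hn1 hd0 hcase
    obtain ⟨m, rfl⟩ : ∃ m, n = m + 1 := ⟨n - 1, by omega⟩
    set t := √(L / 2) with ht
    have ht2 : t ^ 2 = L / 2 := Real.sq_sqrt (by linarith)
    have ht4 : 4 ≤ t := Real.le_sqrt_of_sq_le (by linarith)
    obtain ⟨hI1, hI2⟩ := gauss_Icc t (by linarith)
    have hI3 : (gaussianReal 0 1).real (Set.Icc t (t + 1)) ≤ r := by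
      refine hI2.trans (le_of_eq ?_)
      rw [hr, neg_div, ht2]; ring_nf
    have hno := (prob_no_index (n := m + 1) wstar (Set.Icc t (t + 1)) measurableSet_Icc hw).trans
      (num_noidx _ t _ hn1 ht2 hI1)
    set B2 : Set (Fin (m + 1) → Fin d → ℝ) := {x | ∀ i, dot wstar (x i) ∉ Set.Icc t (t + 1)}
      with hB2
    set B3 : Set (Fin (m + 1) → Fin d → ℝ) := ⋃ i, {x | dot (x i) (x i) ≤ κ * d} with hB3
    set B4 : Set (Fin (m + 1) → Fin d → ℝ) := ⋃ i, {x | x i ∈ dot wstar ⁻¹' Set.Icc t (t + 1) ∧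
      K * (m + 1 : ℕ) ≤ ∑ j, (dot (uperp wstar (x i)) (x (i.succAbove j))) ^ 4} with hB4
    have hPB3 : (sample (m + 1) d).real B3 ≤ 384 / κ ^ 4 * r := by
      refine (measureReal_iUnion_fintype_le _).trans ?_
      have h1 : ∀ i : Fin (m + 1), (sample (m + 1) d).real
          {x : Fin (m + 1) → Fin d → ℝ | dot (x i) (x i) ≤ κ * d} ≤ Real.exp (-(κ * d)) := by
        intro i
        have hmp : MeasurePreserving (fun x : Fin (m + 1) → Fin d → ℝ => x i) (sample (m + 1) d)
          (_root_.stdGaussian d) := measurePreserving_eval _ i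
        have hms : MeasurableSet {y : Fin d → ℝ | dot y y ≤ κ * d} := by
          have : Measurable fun y : Fin d → ℝ => dot y y := by unfold dot; fun_prop
          exact measurableSet_le this measurable_const
        have h2 := hmp.measureReal_preimage hms.nullMeasurableSet
        exact h2.le.trans (hnorm d)
      calc _ ≤ ∑ i : Fin (m + 1), Real.exp (-(κ * d)) := Finset.sum_le_sum fun i _ => h1 i
        _ = (m + 1 : ℕ) * Real.exp (-(κ * d)) := by simp
        _ ≤ _ := hne
        _ = 384 / κ ^ 4 * (1 / (m + 1 : ℕ)) := by ring
        _ ≤ _ := by gcongr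
    have hPB4 : (sample (m + 1) d).real B4 ≤ V * r := by
      refine (measureReal_iUnion_fintype_le _).trans ?_
      have hslice : ∀ y : Fin d → ℝ, (sample m d).real
          {z | K * (m + 1 : ℕ) ≤ ∑ j, (dot (uperp wstar y) (z j)) ^ 4} ≤ V / (m + 1 : ℕ) := by
        intro y
        rcases uperp_cases wstar y with h | h
        · exact hfour d m (m + 1) _ h (by omega) (by omega)
        · have h0 : {z : Fin m → Fin d → ℝ |
              K * (m + 1 : ℕ) ≤ ∑ j, (dot (uperp wstar y) (z j)) ^ 4} = ∅ := by
            ext z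
            have : ¬ (K * (m + 1 : ℕ) ≤ ∑ j : Fin m, (dot (uperp wstar y) (z j)) ^ 4) := by
              rw [h]
              simp only [dot, Pi.zero_apply, zero_mul, Finset.sum_const_zero, not_le]
              norm_num
              positivity
            simpa using this
          rw [h0, measureReal_empty]; positivity
      have hT : (_root_.stdGaussian d).real (dot wstar ⁻¹' Set.Icc t (t + 1)) ≤ r := by
        rw [← map_measureReal_apply (measurable_dot wstar) measurableSet_Icc, map_dot wstar hw]
        exact hI3
      have h1 : ∀ i : Fin (m + 1), (sample (m + 1) d).real
          {x | x i ∈ dot wstar ⁻¹' Set.Icc t (t + 1) ∧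
      K * (m + 1 : ℕ) ≤ ∑ j, (dot (uperp wstar (x i)) (x (i.succAbove j))) ^ 4} ≤
          r * (V / (m + 1 : ℕ)) := by
        intro i
        refine (cond_one i _ (measurable_dot wstar measurableSet_Icc) (uperp wstar)
          (measurable_uperp wstar) _ _ (by positivity) hslice).trans ?_
        gcongr
      calc _ ≤ ∑ i : Fin (m + 1), r * (V / (m + 1 : ℕ)) := Finset.sum_le_sum fun i _ => h1 i
        _ = (m + 1 : ℕ) * (r * (V / (m + 1 : ℕ))) := by simp
        _ = _ := by field_simp
    refine ⟨B1 ∪ B2 ∪ B3 ∪ B4, fun x hx => ?_, ?_⟩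
    · simp only [Set.mem_union, not_or] at hx
      obtain ⟨⟨⟨hx1, hx2⟩, hx3⟩, hx4⟩ := hx
      have ha : ∑ j, (dot wstar (x j)) ^ 4 ≤ K * (m + 1 : ℕ) := by
        by_contra hcon
        exact hx1 (not_le.1 hcon).le
      obtain ⟨i, hi⟩ : ∃ i, dot wstar (x i) ∈ Set.Icc t (t + 1) := by
        by_contra hcon
        exact hx2 (not_exists.1 hcon)
      have hxi : κ * d < dot (x i) (x i) := by
        by_contra hcon
        exact hx3 (Set.mem_iUnion.2 ⟨i, not_lt.1 hcon⟩)
      have hg : ∑ j, (dot (uperp wstar (x i)) (x (i.succAbove j))) ^ 4 ≤ K * (m + 1 : ℕ) := by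
        by_contra hcon
        exact hx4 (Set.mem_iUnion.2 ⟨i, hi, (not_le.1 hcon).le⟩)
      have hYlow : κ * d / 2 ≤ dot (x i) (x i) - dot wstar (x i) ^ 2 := by
        have h1 : dot wstar (x i) ^ 2 ≤ (2 * t) ^ 2 := by
          have := hi.1
          have := hi.2
          apply pow_le_pow_left₀ <;> linarith
        rw [mul_pow, ht2] at h1
        linarith only [h1, hxi, hLd]
      obtain ⟨w, hw1, hw2⟩ := det_hard wstar hw x i K t _ ht4 rfl (by rw [ht2]; linarith only [hYlow, hLd]) hi ha hg
      set Y := dot (x i) (x i) - dot wstar (x i) ^ 2 with hY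
      have hY0 : 0 < Y := lt_of_lt_of_le (by positivity) hYlow
      refine ⟨w, ?_, ?_, hw2.trans ?_⟩
      · rw [hw1]
        have : 0 < √Y := Real.sqrt_pos.2 hY0
        positivity
      · rw [hw1]
        have hd1 : 0 ≤ C * √(L / d) := by positivity
        refine le_of_sq_le_sq ?_ hd1
        rw [div_pow, Real.sq_sqrt hY0.le, mul_pow, Real.sq_sqrt (by positivity),
          div_le_iff₀ hY0]
        have h3 : 3 ≤ C * κ := by
          have h4 : 3 / κ ≤ C := by linarith
          rwa [div_le_iff₀ hκ] at h4
        have h5 : 1 ≤ C := by linarith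
        have h6 : 3 ≤ C ^ 2 * κ := by
          have h7 : C * κ * 1 ≤ C * κ * C := mul_le_mul_of_nonneg_left h5 (by positivity)
          linarith only [h7, h3]
        calc (3 * t / 2) ^ 2 = 9 / 8 * L := by rw [div_pow, mul_pow, ht2]; ring
          _ ≤ (C ^ 2 * κ) * L / 2 := by
            have h8 : 3 * L ≤ C ^ 2 * κ * L := mul_le_mul_of_nonneg_right h6 (by linarith only [hL32])
            linarith only [h8, hL32]
          _ = C ^ 2 * (L / d) * (κ * d / 2) := by field_simp
          _ ≤ C ^ 2 * (L / d) * Y := by gcongr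
      · have h1 : c * (d * L) ≤ Y * t ^ 2 / 8 := by
          have h2 : c * (d * L) ≤ κ / 32 * (d * L) := by gcongr
          have h3 : κ * d / 2 * (L / 2) ≤ Y * t ^ 2 := by rw [ht2]; gcongr
          linarith
        have h2 : -(Y * t ^ 2 / 8) / ((m + 1 : ℕ) : ℝ) ≤ -c * (d * L) / ((m + 1 : ℕ) : ℝ) := by
          gcongr
          linarith
        linarith
    · have u1 := measureReal_union_le (μ := sample (m + 1) d) (B1 ∪ B2 ∪ B3) B4
      have u2 := measureReal_union_le (μ := sample (m + 1) d) (B1 ∪ B2) B3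
      have u3 := measureReal_union_le (μ := sample (m + 1) d) B1 B2
      have : V * r + 12 * r + 384 / κ ^ 4 * r + V * r ≤ C * r := by
        have : (V + 12 + 384 / κ ^ 4 + V) * r ≤ C * r := by
          gcongr
          linarith
        linarith
      linarith
end
end

section
/- Let {(Z_i, Y_i)}_{i=1}^n be i.i.d. pairs with Z_i ~ N(0, I_d) and Y_i ~ N(0, 1), with (Z_1, …, Z_n) independent of (Y_1, …, Y_n). There exist absolute constants C, c > 0 such that if C √((log n)/d) ≤ γ ≤ 1, then with probability at least 1 − C e^{−c √d} − C e^{−c log n}, one has min over nonzero δ ∈ R^d with ‖δ‖ ≤ γ of (1/n) Σ_{i=1}^n (Z_i^⊤ δ/‖δ‖)² · (3 (Z_i^⊤ δ)² + 6 (Z_i^⊤ δ) Y_i + 2 Y_i²) ≤ −c (d log n)/n + C. -/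
open MeasureTheory ProbabilityTheory Real

noncomputable section

/-- Joint law of i.i.d. pairs `(Z_i, Y_i)` with `Z_i ~ N(0, I_d)`, `Y_i ~ N(0,1)`, and the
`Z`'s independent of the `Y`'s. -/
def samplePairs (n d : ℕ) : Measure ((Fin n → Fin d → ℝ) × (Fin n → ℝ)) :=
  (sample n d).prod (Measure.pi fun _ : Fin n => gaussianReal 0 1)

/-- Chebyshev for sums of i.i.d. variables. -/
lemma cheb_aux {Ω : Type*} [MeasurableSpace Ω] (P : Measure Ω) [IsProbabilityMeasure P]
    (f : Ω → ℝ) (hf : MemLp f 2 P) (hE : 0 ≤ ∫ x, f x ∂P) (m n : ℕ) (hmn : m ≤ n) (hn : 0 < n) :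
    (Measure.pi (fun _ : Fin m => P)) {w | ((∫ x, f x ∂P) + 1) * n < ∑ i, f (w i)} ≤
      ENNReal.ofReal (Var[f; P] / n) := by
  have hnpos : (0:ℝ) < n := by exact_mod_cast hn
  have hmp : ∀ i : Fin m, MeasurePreserving (Function.eval i) (Measure.pi (fun _ : Fin m => P)) P :=
    fun i => measurePreserving_eval _ i
  have hi : ∀ i : Fin m, MemLp (fun w : Fin m → Ω => f (w i)) 2 (Measure.pi (fun _ : Fin m => P)) :=
    fun i => hf.comp_measurePreserving (hmp i)
  have hX : MemLp (∑ i : Fin m, fun w : Fin m → Ω => f (w i)) 2 (Measure.pi (fun _ : Fin m => P)) :=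
    memLp_finsetSum' _ (fun i _ => hi i)
  have hEX : ∫ w, (∑ i : Fin m, fun w : Fin m → Ω => f (w i)) w ∂(Measure.pi (fun _ : Fin m => P))
      = m * ∫ x, f x ∂P := by
    simp only [Finset.sum_apply]
    rw [integral_finsetSum _ (fun i _ => (hi i).integrable (by norm_num))]
    have : ∀ i : Fin m, ∫ w : Fin m → Ω, f (w i) ∂(Measure.pi (fun _ : Fin m => P)) = ∫ x, f x ∂P := by
      intro i
      have h1 := integral_map (μ := Measure.pi (fun _ : Fin m => P)) (φ := Function.eval i)
        (hmp i).measurable.aemeasurable (f := f) (by rw [(hmp i).map_eq]; exact hf.1)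
      rw [(hmp i).map_eq] at h1
      exact h1.symm
    simp [this]
  have hV : Var[∑ i : Fin m, fun w : Fin m → Ω => f (w i); Measure.pi (fun _ : Fin m => P)]
      = m * Var[f; P] := by
    rw [variance_sum_pi (μ := fun _ : Fin m => P) (X := fun _ => f) (fun _ => hf)]
    simp
  have key := meas_ge_le_variance_div_sq hX hnpos
  rw [hV, hEX] at key
  refine (measure_mono ?_).trans (key.trans (ENNReal.ofReal_le_ofReal ?_))
  · intro w hw
    simp only [Set.mem_setOf_eq, Finset.sum_apply] at hw ⊢
    refine le_trans ?_ (le_abs_self _)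
    have : (m:ℝ) * ∫ x, f x ∂P ≤ n * ∫ x, f x ∂P := by gcongr
    linarith
  · have hv : 0 ≤ Var[f; P] := variance_nonneg _ _
    rw [div_le_div_iff₀ (by positivity) hnpos]
    have : (m:ℝ) ≤ n := by exact_mod_cast hmn
    nlinarith [mul_le_mul_of_nonneg_right this (mul_nonneg hv hnpos.le)]

lemma memLp_pow4 : MemLp (fun x : ℝ => x ^ 4) 2 (gaussianReal 0 1) := by
  have h8 : MemLp (id : ℝ → ℝ) 8 (gaussianReal 0 1) := memLp_id_gaussianReal' 8 (by simp)
  have h2 : Integrable (fun x : ℝ => x ^ 8) (gaussianReal 0 1) := by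
    have := h8.integrable_norm_pow (p := 8) (by norm_num)
    refine this.congr (Filter.Eventually.of_forall fun x => ?_)
    simp only [id, Real.norm_eq_abs]
    exact (Even.pow_abs (by decide) x)
  refine (memLp_two_iff_integrable_sq (by fun_prop)).2 ?_
  refine h2.congr (Filter.Eventually.of_forall fun x => ?_)
  simp only
  ring

/-- Gaussian law of the projection. -/
lemma dot_law {d : ℕ} (u : Fin d → ℝ) (hu : ∑ j, (u j) ^ 2 = 1) :
    MeasurePreserving (fun z => dot z u) (_root_.stdGaussian d) (gaussianReal 0 1) := by
  have hm : Measurable (fun z : Fin d → ℝ => dot z u) := by unfold dot; fun_prop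
  refine ⟨hm, ?_⟩
  haveI : IsProbabilityMeasure (_root_.stdGaussian d) := by
    unfold _root_.stdGaussian; infer_instance
  haveI := Measure.isProbabilityMeasure_map (μ := _root_.stdGaussian d) hm.aemeasurable
  apply Measure.ext_of_charFun
  ext t
  rw [charFun_apply_real, integral_map hm.aemeasurable (by fun_prop)]
  have : ∀ z : Fin d → ℝ, Complex.exp (t * (dot z u : ℝ) * Complex.I)
      = ∏ j, Complex.exp (((t * u j : ℝ) : ℂ) * (z j) * Complex.I) := by
    intro z
    rw [← Complex.exp_sum]
    congr 1
    simp only [dot]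
    push_cast
    rw [Finset.mul_sum, Finset.sum_mul]
    refine Finset.sum_congr rfl fun j _ => ?_
    ring
  simp_rw [this]
  unfold _root_.stdGaussian
  rw [integral_fintype_prod_eq_prod (μ := fun _ : Fin d => gaussianReal 0 1)
    (f := fun j (x : ℝ) => Complex.exp (((t * u j : ℝ) : ℂ) * x * Complex.I))]
  simp_rw [← charFun_apply_real, charFun_gaussianReal]
  rw [← Complex.exp_sum]
  congr 1
  have h2 : (∑ j, ((u j : ℂ)) ^ 2) = 1 := by exact_mod_cast hu
  simp only [Complex.ofReal_mul, mul_pow]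
  simp [← Finset.mul_sum, ← Finset.sum_div, h2]

lemma gauss_mgf_sq : ∫ x, Real.exp (-(3/2) * x ^ 2) ∂(gaussianReal 0 1) = 1 / 2 := by
  rw [integral_gaussianReal_eq_integral_smul (by norm_num)]
  have : ∀ x : ℝ, gaussianPDFReal 0 1 x • Real.exp (-(3/2) * x ^ 2)
      = (√(2 * π))⁻¹ * Real.exp (-2 * x ^ 2) := by
    intro x
    simp only [gaussianPDFReal, smul_eq_mul, NNReal.coe_one, mul_one, sub_zero]
    rw [mul_assoc, ← Real.exp_add]
    congr 2
    ring
  simp_rw [this]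
  rw [integral_const_mul, integral_gaussian, ← Real.sqrt_inv, ← Real.sqrt_mul (by positivity)]
  have : (2 * π)⁻¹ * (π / 2) = (1/2) ^ 2 := by
    have := Real.pi_pos.ne'
    field_simp
  rw [this, Real.sqrt_sq (by norm_num)]

lemma norm_tail (d : ℕ) :
    (_root_.stdGaussian d) {z | ∑ j, (z j) ^ 2 < (d : ℝ) / 4} ≤
      ENNReal.ofReal (Real.exp (-(1/16) * d)) := by
  have : IsProbabilityMeasure (_root_.stdGaussian d) := by
    unfold _root_.stdGaussian; infer_instance
  have hI : ∫ z, Real.exp (-(3/2) * ∑ j, (z j) ^ 2) ∂(_root_.stdGaussian d) = (1/2) ^ d := by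
    have : ∀ z : Fin d → ℝ, Real.exp (-(3/2) * ∑ j, (z j) ^ 2)
        = ∏ j, Real.exp (-(3/2) * (z j) ^ 2) := by
      intro z
      rw [← Real.exp_sum, Finset.mul_sum]
    simp_rw [this]
    unfold _root_.stdGaussian
    rw [integral_fintype_prod_eq_prod (μ := fun _ : Fin d => gaussianReal 0 1)
      (f := fun j (x : ℝ) => Real.exp (-(3/2) * x ^ 2))]
    simp only [gauss_mgf_sq, Finset.prod_const, Finset.card_univ, Fintype.card_fin]
  have hint : Integrable (fun z : Fin d → ℝ => Real.exp (-(3/2) * ∑ j, (z j) ^ 2))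
      (_root_.stdGaussian d) := by
    refine Integrable.of_bound (C := 1) (Measurable.aestronglyMeasurable (by fun_prop)) ?_
    refine Filter.Eventually.of_forall fun z => ?_
    rw [Real.norm_eq_abs, abs_of_pos (Real.exp_pos _), Real.exp_le_one_iff]
    have : 0 ≤ ∑ j, (z j) ^ 2 := Finset.sum_nonneg fun _ _ => sq_nonneg _
    linarith
  have hM := mul_meas_ge_le_integral_of_nonneg
    (Filter.Eventually.of_forall fun z => (Real.exp_pos _).le) hint (Real.exp (-(3/8) * d))
  rw [hI] at hM
  have hsub : {z : Fin d → ℝ | ∑ j, (z j) ^ 2 < (d : ℝ) / 4} ⊆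
      {z | Real.exp (-(3/8) * d) ≤ Real.exp (-(3/2) * ∑ j, (z j) ^ 2)} := by
    intro z hz
    have hz' : ∑ j, (z j) ^ 2 < (d : ℝ) / 4 := hz
    change Real.exp (-(3/8) * d) ≤ Real.exp (-(3/2) * ∑ j, (z j) ^ 2)
    rw [Real.exp_le_exp]
    linarith
  refine (measure_mono hsub).trans ?_
  rw [← ENNReal.ofReal_toReal (measure_ne_top (_root_.stdGaussian d) _)]
  apply ENNReal.ofReal_le_ofReal
  rw [← Measure.real]
  have hpos := Real.exp_pos (-(3/8) * (d:ℝ))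
  rw [← le_div_iff₀' hpos] at hM
  refine hM.trans ?_
  rw [div_le_iff₀ hpos, ← Real.exp_add]
  have h1 : (1/2 : ℝ) ≤ Real.exp (-(7/16)) := by
    rw [Real.exp_neg, one_div]
    apply inv_anti₀ (Real.exp_pos _)
    have h2 : Real.exp (7/16) ≤ Real.exp (1/2) := Real.exp_le_exp.2 (by norm_num)
    have h3 : Real.exp (1/2) ^ 2 = Real.exp 1 := by rw [← Real.exp_nat_mul]; norm_num
    have h4 := Real.exp_one_lt_d9
    nlinarith [Real.exp_pos (1/2)]
  calc (1/2 : ℝ) ^ d ≤ Real.exp (-(7/16)) ^ d := by gcongr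
    _ = Real.exp (-(1/16) * d + -(3/8) * d) := by
      rw [← Real.exp_nat_mul]; congr 1; ring

lemma interval_prob (r : ℝ) (hr : 0 ≤ r) :
    r * ((√(2 * π))⁻¹ * Real.exp (-(2 * r ^ 2))) ≤ (gaussianReal 0 1).real (Set.Icc r (2 * r)) := by
  rw [Measure.real, ← ENNReal.ofReal_le_iff_le_toReal (measure_ne_top _ _),
    gaussianReal_apply _ (by norm_num)]
  calc ENNReal.ofReal (r * ((√(2 * π))⁻¹ * Real.exp (-(2 * r ^ 2))))
      = ∫⁻ x in Set.Icc r (2 * r), ENNReal.ofReal ((√(2 * π))⁻¹ * Real.exp (-(2 * r ^ 2))) := by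
        rw [setLIntegral_const, Real.volume_Icc, ← ENNReal.ofReal_mul (by positivity)]
        congr 1; ring
    _ ≤ _ := by
        refine setLIntegral_mono (measurable_gaussianPDF _ _) fun x hx => ?_
        apply ENNReal.ofReal_le_ofReal
        simp only [gaussianPDFReal, NNReal.coe_one, mul_one, sub_zero]
        gcongr
        have := hx.1
        have := hx.2
        nlinarith

lemma none_prob (n : ℕ) (hn : 2 ≤ n) :
    (Measure.pi fun _ : Fin n => gaussianReal 0 1)
      {y | ∀ i, y i ∉ Set.Icc (√(Real.log n) / 2) (2 * (√(Real.log n) / 2))} ≤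
      ENNReal.ofReal (12 * Real.exp (-(1/2) * Real.log n)) := by
  set r := √(Real.log n) / 2 with hr
  have hn2 : (2:ℝ) ≤ n := by exact_mod_cast hn
  have hn0 : (0:ℝ) < n := by linarith
  have hlog : 1/4 ≤ Real.log n := by
    have h1 := Real.log_two_gt_d9
    have h2 : Real.log 2 ≤ Real.log n := Real.log_le_log (by norm_num) hn2
    linarith
  have hr4 : 1/4 ≤ r := by
    have : (1/2:ℝ) ≤ √(Real.log n) := Real.le_sqrt_of_sq_le (by linarith)
    linarith
  have hr2 : 2 * r ^ 2 = (1/2) * Real.log n := by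
    rw [hr, div_pow, Real.sq_sqrt (by linarith)]; ring
  set p := (gaussianReal 0 1).real (Set.Icc r (2 * r)) with hp
  have hpl := interval_prob r (by linarith)
  rw [hr2] at hpl
  have heq : {y : Fin n → ℝ | ∀ i, y i ∉ Set.Icc r (2 * r)} =
      Set.pi Set.univ (fun _ => (Set.Icc r (2 * r))ᶜ) := by
    ext y; simp [Set.mem_pi]
  rw [heq, Measure.pi_pi, Finset.prod_const, Finset.card_univ, Fintype.card_fin]
  have hc : (gaussianReal 0 1) (Set.Icc r (2 * r))ᶜ = ENNReal.ofReal (1 - p) := by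
    rw [← ENNReal.ofReal_toReal (measure_ne_top (gaussianReal 0 1) _), ← Measure.real,
      probReal_compl_eq_one_sub measurableSet_Icc]
  have hp1 : p ≤ 1 := measureReal_le_one
  rw [hc, ← ENNReal.ofReal_pow (by linarith)]
  apply ENNReal.ofReal_le_ofReal
  set E := Real.exp (-((1/2) * Real.log n)) with hE
  have hEpos : 0 < E := Real.exp_pos _
  have hEE : E * E * n = 1 := by
    rw [hE, ← Real.exp_add]
    have : -(1 / 2 * Real.log n) + -(1 / 2 * Real.log n) = - Real.log n := by ring
    rw [this, Real.exp_neg, Real.exp_log hn0, inv_mul_cancel₀ hn0.ne']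
  have hs : (1/3 : ℝ) ≤ (√(2 * π))⁻¹ := by
    rw [one_div]
    apply inv_anti₀ (by positivity)
    rw [Real.sqrt_le_left (by norm_num)]
    have := Real.pi_lt_d2
    linarith
  have hpE : (1/12) * E ≤ p := by
    refine le_trans ?_ hpl
    have : (1/4) * ((1/3) * E) ≤ r * ((√(2 * π))⁻¹ * E) := by gcongr
    linarith
  have h1 : (1 - p) ^ n ≤ Real.exp (-(n * p)) := by
    calc (1 - p) ^ n ≤ Real.exp (-p) ^ n := by
          apply pow_le_pow_left₀ (by linarith)
          have := Real.add_one_le_exp (-p); linarith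
      _ = Real.exp (-(n * p)) := by rw [← Real.exp_nat_mul]; congr 1; ring
  refine h1.trans ?_
  have h2 : n * p * Real.exp (-(n * p)) ≤ 1 := by
    have h3 := Real.add_one_le_exp (n * p)
    rw [Real.exp_neg]
    rw [← div_eq_mul_inv, div_le_one (Real.exp_pos _)]
    linarith
  have h4 : (1/12) * E * n ≤ n * p := by nlinarith
  have h5 : (1/12) * E * n * Real.exp (-(n * p)) ≤ 1 :=
    (mul_le_mul_of_nonneg_right h4 (Real.exp_pos _).le).trans h2
  have h6 : -(1/2) * Real.log n = -((1/2) * Real.log n) := by ring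
  rw [h6, ← hE]
  have h7 : E * E * n * Real.exp (-(n * p)) ≤ 12 * E := by nlinarith
  rw [hEE] at h7
  linarith

/-- Fourth moment of the standard Gaussian plus one. -/
def MM : ℝ := (∫ x : ℝ, x ^ 4 ∂(gaussianReal 0 1)) + 1

/-- Variance of the fourth power. -/
def VV : ℝ := Var[fun x : ℝ => x ^ 4; gaussianReal 0 1]

lemma E4_nonneg : 0 ≤ ∫ x : ℝ, x ^ 4 ∂(gaussianReal 0 1) :=
  integral_nonneg fun x => by positivity

lemma VV_nonneg : 0 ≤ VV := variance_nonneg _ _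

lemma MM_nonneg : 0 ≤ MM := by
  have := E4_nonneg
  unfold MM; linarith

lemma proj_cheb {d : ℕ} (u : Fin d → ℝ) (hu : ∑ j, (u j) ^ 2 = 1) (m n : ℕ) (hmn : m ≤ n)
    (hn : 0 < n) :
    (Measure.pi (fun _ : Fin m => _root_.stdGaussian d)) {w | MM * n < ∑ i, (dot (w i) u) ^ 4} ≤
      ENNReal.ofReal (VV / n) := by
  have hl := dot_law u hu
  have : IsProbabilityMeasure (_root_.stdGaussian d) := by
    unfold _root_.stdGaussian; infer_instance
  have hmem : MemLp (fun z => (dot z u) ^ 4) 2 (_root_.stdGaussian d) :=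
    memLp_pow4.comp_measurePreserving hl
  have hE : ∫ z, (dot z u) ^ 4 ∂(_root_.stdGaussian d) = ∫ x : ℝ, x ^ 4 ∂(gaussianReal 0 1) := by
    have h1 := integral_map (μ := _root_.stdGaussian d) (φ := fun z => dot z u)
        hl.measurable.aemeasurable (f := fun x : ℝ => x ^ 4) (by fun_prop)
    rw [hl.map_eq] at h1
    exact h1.symm
  have hV : Var[fun z => (dot z u) ^ 4; _root_.stdGaussian d] = VV := by
    have h1 := variance_map (μ := _root_.stdGaussian d) (X := fun x : ℝ => x ^ 4)
      (Y := fun z => dot z u) (by fun_prop) hl.measurable.aemeasurable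
    rw [hl.map_eq] at h1
    exact h1.symm
  have h := cheb_aux (_root_.stdGaussian d) _ hmem (by rw [hE]; exact E4_nonneg) m n hmn hn
  rw [hE, hV] at h
  exact h

lemma dot_smul {d : ℕ} (x v : Fin d → ℝ) (a : ℝ) : dot x (fun j => a * v j) = a * dot x v := by
  simp only [dot, Finset.mul_sum]
  exact Finset.sum_congr rfl fun _ _ => by ring

lemma g_bad (m d : ℕ) (j : Fin (m + 1)) :
    (sample (m + 1) d) {z | 0 < ∑ k, (z j k) ^ 2 ∧
      MM * ((m + 1 : ℕ) : ℝ) * (∑ k, (z j k) ^ 2) ^ 2 <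
        ∑ i : Fin m, (dot (z (j.succAbove i)) (z j)) ^ 4} ≤ ENNReal.ofReal (VV / (m + 1 : ℕ)) := by
  have : IsProbabilityMeasure (_root_.stdGaussian d) := by
    unfold _root_.stdGaussian; infer_instance
  have hmp := measurePreserving_piFinSuccAbove (fun _ : Fin (m + 1) => _root_.stdGaussian d) j
  set T : Set ((Fin d → ℝ) × (Fin m → Fin d → ℝ)) := {q | 0 < ∑ k, (q.1 k) ^ 2 ∧
      MM * ((m + 1 : ℕ) : ℝ) * (∑ k, (q.1 k) ^ 2) ^ 2 <
        ∑ i : Fin m, (dot (q.2 i) q.1) ^ 4} with hT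
  have hTm : MeasurableSet T := by
    have h1 : MeasurableSet {q : (Fin d → ℝ) × (Fin m → Fin d → ℝ) | 0 < ∑ k, (q.1 k) ^ 2} :=
      measurableSet_lt (by fun_prop) (by fun_prop)
    have h2 : MeasurableSet {q : (Fin d → ℝ) × (Fin m → Fin d → ℝ) |
        MM * ((m + 1 : ℕ) : ℝ) * (∑ k, (q.1 k) ^ 2) ^ 2 < ∑ i : Fin m, (dot (q.2 i) q.1) ^ 4} :=
      measurableSet_lt (by fun_prop) (by unfold dot; fun_prop)
    exact h1.inter h2
  have hpre := hmp.measure_preimage hTm.nullMeasurableSet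
  have hset : {z : Fin (m + 1) → Fin d → ℝ | 0 < ∑ k, (z j k) ^ 2 ∧
      MM * ((m + 1 : ℕ) : ℝ) * (∑ k, (z j k) ^ 2) ^ 2 <
        ∑ i : Fin m, (dot (z (j.succAbove i)) (z j)) ^ 4} =
      (MeasurableEquiv.piFinSuccAbove (fun _ : Fin (m + 1) => Fin d → ℝ) j) ⁻¹' T := by
    ext z
    rfl
  rw [hset]
  unfold sample
  rw [hpre, Measure.prod_apply hTm]
  calc _ ≤ ∫⁻ _ : Fin d → ℝ, ENNReal.ofReal (VV / (m + 1 : ℕ)) ∂(_root_.stdGaussian d) := by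
        refine lintegral_mono fun v => ?_
        by_cases hv : 0 < ∑ k, (v k) ^ 2
        · set s := √(∑ k, (v k) ^ 2) with hs
          have hs0 : 0 < s := Real.sqrt_pos.2 hv
          have hs2 : s ^ 2 = ∑ k, (v k) ^ 2 := Real.sq_sqrt hv.le
          have hu : ∑ k, ((fun k => s⁻¹ * v k) k) ^ 2 = 1 := by
            simp only [mul_pow, ← Finset.mul_sum, ← hs2]
            field_simp
          refine le_trans (measure_mono ?_) (proj_cheb _ hu m (m + 1) (Nat.le_succ m) (Nat.succ_pos m))
          rintro w ⟨-, hw⟩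
          simp only at hw
          change MM * ((m + 1 : ℕ) : ℝ) < ∑ i : Fin m, (dot (w i) (fun k => s⁻¹ * v k)) ^ 4
          simp only [dot_smul, mul_pow, ← Finset.mul_sum]
          rw [← hs2] at hw
          rw [inv_pow, ← div_eq_inv_mul, lt_div_iff₀ (by positivity)]
          calc _ = MM * ((m + 1 : ℕ) : ℝ) * (s ^ 2) ^ 2 := by ring
            _ < _ := hw
        · have : Prod.mk v ⁻¹' T = ∅ := by
            ext w
            simp only [hT, Set.mem_preimage, Set.mem_empty_iff_false, iff_false]
            exact fun h => hv h.1
          rw [this]; simp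
    _ = _ := by simp

lemma poly_aux (t g Y : ℝ) (ht0 : 0 ≤ t) (ht1 : t ≤ 1) :
    g ^ 2 * (3 * (t * g) ^ 2 + 6 * (t * g) * Y + 2 * Y ^ 2) ≤ 9 * g ^ 4 + 3 * Y ^ 4 := by
  have ht2 : t ^ 2 ≤ 1 := by nlinarith
  have h0 : t ^ 2 * g ^ 2 ≤ 1 * g ^ 2 := mul_le_mul_of_nonneg_right ht2 (sq_nonneg g)
  have h1 : 3 * (t * g) ^ 2 + 6 * (t * g) * Y + 2 * Y ^ 2 ≤ 6 * g ^ 2 + 5 * Y ^ 2 := by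
    have h2 := sq_nonneg (t * g - Y)
    linarith
  have h2 := mul_le_mul_of_nonneg_left h1 (sq_nonneg g)
  have h3 := sq_nonneg (g ^ 2 - Y ^ 2)
  have h4 := sq_nonneg (g ^ 2)
  have h5 := sq_nonneg (Y ^ 2)
  linarith

/-- Deterministic part. -/
lemma det_part (m d : ℕ) (γ : ℝ) (hd : 0 < d) (hm : 1 ≤ m)
    (hγ : √(Real.log ((m + 1 : ℕ) : ℝ) / d) ≤ γ) (hγ1 : γ ≤ 1)
    (z : Fin (m + 1) → Fin d → ℝ) (y : Fin (m + 1) → ℝ) (j : Fin (m + 1))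
    (hy : y j ∈ Set.Icc (√(Real.log ((m + 1 : ℕ) : ℝ)) / 2) (2 * (√(Real.log ((m + 1 : ℕ) : ℝ)) / 2)))
    (hz : (d : ℝ) / 4 ≤ ∑ k, (z j k) ^ 2)
    (hg : ∑ i : Fin m, (dot (z (j.succAbove i)) (z j)) ^ 4 ≤
      MM * ((m + 1 : ℕ) : ℝ) * (∑ k, (z j k) ^ 2) ^ 2)
    (hY : ∑ i, (y i) ^ 4 ≤ MM * ((m + 1 : ℕ) : ℝ)) :
    ∃ δ : Fin d → ℝ, δ ≠ 0 ∧ nrm δ ≤ γ ∧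
      (1 / ((m + 1 : ℕ) : ℝ)) * ∑ i, (dot (z i) δ / nrm δ) ^ 2 *
        (3 * (dot (z i) δ) ^ 2 + 6 * (dot (z i) δ) * y i + 2 * (y i) ^ 2) ≤
      -(1/16) * ((d : ℝ) * Real.log ((m + 1 : ℕ) : ℝ)) / ((m + 1 : ℕ) : ℝ) + 12 * MM := by
  set N : ℝ := ((m + 1 : ℕ) : ℝ) with hN
  have hN2 : 2 ≤ N := by rw [hN]; exact_mod_cast Nat.succ_le_succ hm
  have hlog : 0 < Real.log N := Real.log_pos (by linarith)
  have hdpos : (0:ℝ) < d := by exact_mod_cast hd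
  set r := √(Real.log N) / 2 with hr
  have hr0 : 0 < r := by have := Real.sqrt_pos.2 hlog; positivity
  have hr2 : r ^ 2 = Real.log N / 4 := by rw [hr, div_pow, Real.sq_sqrt hlog.le]; norm_num
  set Q := ∑ k, (z j k) ^ 2 with hQ
  have hQ0 : 0 < Q := by linarith
  set s := √Q with hs
  have hs0 : 0 < s := Real.sqrt_pos.2 hQ0
  have hs2 : s ^ 2 = Q := Real.sq_sqrt hQ0.le
  set t := r / s with ht
  have ht0 : 0 < t := by positivity
  have htγ : t ≤ γ := by
    refine le_trans ?_ hγ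
    apply Real.le_sqrt_of_sq_le
    rw [ht, div_pow, hr2, hs2, div_le_div_iff₀ hQ0 hdpos]
    nlinarith
  set a := -(r / Q) with ha
  have hnrm : nrm (fun k => a * z j k) = t := by
    unfold nrm
    simp only [mul_pow, ← Finset.mul_sum]
    rw [← hQ, ← hs2]
    have : a ^ 2 * s ^ 2 = t ^ 2 := by
      rw [ha, ht, ← hs2]; field_simp
    rw [this, Real.sqrt_sq ht0.le]
  refine ⟨fun k => a * z j k, ?_, by rw [hnrm]; exact htγ, ?_⟩
  · intro h0
    rw [h0] at hnrm
    simp [nrm] at hnrm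
    linarith
  rw [hnrm]
  simp only [dot_smul]
  rw [Fin.sum_univ_succAbove _ j]
  have hself : dot (z j) (z j) = Q := by
    simp only [dot, hQ]; exact Finset.sum_congr rfl fun _ _ => by ring
  rw [hself]
  have haQ : a * Q = -r := by rw [ha]; field_simp
  rw [haQ]
  have hfirst : (-r / t) ^ 2 * (3 * (-r) ^ 2 + 6 * (-r) * y j + 2 * y j ^ 2) ≤
      -(1/16) * (d * Real.log N) := by
    have h1 : (-r / t) ^ 2 = Q := by rw [ht, ← hs2]; field_simp
    rw [h1]
    have h2 : 3 * (-r) ^ 2 + 6 * (-r) * y j + 2 * y j ^ 2 ≤ - r ^ 2 := by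
      nlinarith [mul_nonneg (sub_nonneg.2 hy.1) (sub_nonneg.2 hy.2)]
    have h3 : Q * (3 * (-r) ^ 2 + 6 * (-r) * y j + 2 * y j ^ 2) ≤ Q * (- r ^ 2) := by gcongr
    have h4 : (d : ℝ) / 4 * r ^ 2 ≤ Q * r ^ 2 := by gcongr
    rw [hr2] at h3 h4
    linarith
  have hrest : ∀ i : Fin m, (a * dot (z (j.succAbove i)) (z j) / t) ^ 2 *
      (3 * (a * dot (z (j.succAbove i)) (z j)) ^ 2 +
        6 * (a * dot (z (j.succAbove i)) (z j)) * y (j.succAbove i) + 2 * (y (j.succAbove i)) ^ 2) ≤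
      9 * ((dot (z (j.succAbove i)) (z j)) ^ 4 / Q ^ 2) + 3 * (y (j.succAbove i)) ^ 4 := by
    intro i
    set D := dot (z (j.succAbove i)) (z j)
    set Y := y (j.succAbove i)
    set g := a * D / t with hg'
    have hg4 : D ^ 4 / Q ^ 2 = g ^ 4 := by
      rw [hg', ha, ht, ← hs2]; field_simp
    have haD : a * D = t * g := by rw [hg']; field_simp
    rw [hg4, haD]
    have ht1 : t ≤ 1 := htγ.trans hγ1
    exact poly_aux t g Y ht0.le ht1
  have hsum := Finset.sum_le_sum (fun i (_ : i ∈ Finset.univ) => hrest i)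
  rw [Finset.sum_add_distrib, ← Finset.mul_sum, ← Finset.mul_sum, ← Finset.sum_div] at hsum
  have hY' : ∑ i : Fin m, (y (j.succAbove i)) ^ 4 ≤ MM * N := by
    rw [Fin.sum_univ_succAbove _ j] at hY
    have : 0 ≤ y j ^ 4 := by positivity
    linarith
  have hg' : (∑ i : Fin m, (dot (z (j.succAbove i)) (z j)) ^ 4) / Q ^ 2 ≤ MM * N := by
    rw [div_le_iff₀ (by positivity)]; exact hg
  have hNpos : 0 < N := by linarith
  rw [one_div, inv_mul_le_iff₀ hNpos, mul_add N, mul_div_cancel₀ _ hNpos.ne']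
  linarith

theorem stmt9 :
    ∃ C > (0 : ℝ), ∃ c > (0 : ℝ),
      ∀ (n d : ℕ) (γ : ℝ),
        C * Real.sqrt (Real.log n / d) ≤ γ → γ ≤ 1 →
        1 - C * Real.exp (-c * Real.sqrt d) - C * Real.exp (-c * Real.log n) ≤
          (samplePairs n d
            {p | ∃ δ : Fin d → ℝ, δ ≠ 0 ∧ nrm δ ≤ γ ∧
              (1 / n) * ∑ i, (dot (p.1 i) δ / nrm δ) ^ 2 *
                  (3 * (dot (p.1 i) δ) ^ 2 + 6 * (dot (p.1 i) δ) * p.2 i + 2 * (p.2 i) ^ 2) ≤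
                -c * ((d : ℝ) * Real.log n) / n + C}).toReal := by
  have hM := MM_nonneg
  have hV := VV_nonneg
  refine ⟨12 + 12 * MM + 2 * VV, by positivity, 1/16, by norm_num, ?_⟩
  intro n d γ hγ hγ1
  set C : ℝ := 12 + 12 * MM + 2 * VV with hC
  have hC1 : 1 ≤ C := by linarith
  rcases Nat.eq_zero_or_pos d with hd | hd
  · refine le_trans ?_ ENNReal.toReal_nonneg
    subst hd
    have := Real.exp_pos (-(1/16) * Real.log n)
    simp only [Nat.cast_zero, Real.sqrt_zero, mul_zero, Real.exp_zero]
    nlinarith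
  rcases Nat.lt_or_ge n 2 with hn | hn
  · refine le_trans ?_ ENNReal.toReal_nonneg
    have h0 : Real.log n = 0 := by interval_cases n <;> simp
    have := Real.exp_pos (-(1/16) * √d)
    simp only [h0, mul_zero, Real.exp_zero]
    nlinarith
  obtain ⟨m, rfl⟩ : ∃ m, n = m + 1 := ⟨n - 1, by omega⟩
  have hm : 1 ≤ m := by omega
  have hPd : IsProbabilityMeasure (_root_.stdGaussian d) := by
    unfold _root_.stdGaussian; infer_instance
  have hPs : IsProbabilityMeasure (sample (m + 1) d) := by
    unfold sample; infer_instance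
  have hPp : IsProbabilityMeasure (samplePairs (m + 1) d) := by
    unfold samplePairs; infer_instance
  set S : Set ((Fin (m + 1) → Fin d → ℝ) × (Fin (m + 1) → ℝ)) :=
    {p | ∃ δ : Fin d → ℝ, δ ≠ 0 ∧ nrm δ ≤ γ ∧
              (1 / ((m + 1 : ℕ) : ℝ)) * ∑ i, (dot (p.1 i) δ / nrm δ) ^ 2 *
                  (3 * (dot (p.1 i) δ) ^ 2 + 6 * (dot (p.1 i) δ) * p.2 i + 2 * (p.2 i) ^ 2) ≤
                -(1/16) * ((d : ℝ) * Real.log ((m + 1 : ℕ) : ℝ)) / ((m + 1 : ℕ) : ℝ) + C} with hS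
  set N : ℝ := ((m + 1 : ℕ) : ℝ) with hN
  set r := √(Real.log N) / 2 with hr
  set G : Measure (Fin (m + 1) → ℝ) := Measure.pi fun _ => gaussianReal 0 1 with hG
  -- bad sets
  set A : Set (Fin (m + 1) → ℝ) := {y | MM * N < ∑ i, (y i) ^ 4} with hA
  set B : Set (Fin (m + 1) → ℝ) := {y | ∀ i, y i ∉ Set.Icc r (2 * r)} with hB
  set K : Fin (m + 1) → Set (Fin (m + 1) → ℝ) := fun j =>
    {y | y j ∈ Set.Icc r (2 * r) ∧ ∀ i < j, y i ∉ Set.Icc r (2 * r)} with hK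
  set D1 : Fin (m + 1) → Set (Fin (m + 1) → Fin d → ℝ) := fun j =>
    {z | ∑ k, (z j k) ^ 2 < (d : ℝ) / 4} with hD1
  set D2 : Fin (m + 1) → Set (Fin (m + 1) → Fin d → ℝ) := fun j =>
    {z | 0 < ∑ k, (z j k) ^ 2 ∧ MM * N * (∑ k, (z j k) ^ 2) ^ 2 <
        ∑ i : Fin m, (dot (z (j.succAbove i)) (z j)) ^ 4} with hD2
  have hdpos : (0:ℝ) < d := by exact_mod_cast hd
  have hγ' : √(Real.log N / d) ≤ γ := by
    refine le_trans ?_ hγ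
    nlinarith [Real.sqrt_nonneg (Real.log N / d)]
  have hcover : Sᶜ ⊆ (Set.univ ×ˢ A ∪ Set.univ ×ˢ B) ∪ ⋃ j, (D1 j ∪ D2 j) ×ˢ K j := by
    intro p hp
    by_contra hcon
    apply hp
    simp only [Set.mem_union, Set.mem_prod, Set.mem_univ, true_and, Set.mem_iUnion, not_or,
      not_exists] at hcon
    obtain ⟨⟨hcA, hcB⟩, hcD⟩ := hcon
    have hY : ∑ i, (p.2 i) ^ 4 ≤ MM * N := not_lt.1 hcA
    have hex : ∃ i, p.2 i ∈ Set.Icc r (2 * r) := by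
      by_contra h
      exact hcB (fun i hi => h ⟨i, hi⟩)
    classical
    obtain ⟨j, hj, hjmin⟩ : ∃ j, p.2 j ∈ Set.Icc r (2 * r) ∧
        ∀ i < j, p.2 i ∉ Set.Icc r (2 * r) := by
      have hne : (Finset.univ.filter fun i => p.2 i ∈ Set.Icc r (2 * r)).Nonempty := by
        obtain ⟨i, hi⟩ := hex
        exact ⟨i, by simpa using hi⟩
      refine ⟨Finset.min' _ hne, ?_, ?_⟩
      · have := Finset.min'_mem _ hne
        exact (Finset.mem_filter.1 this).2
      · intro i hi hmem
        exact absurd (Finset.min'_le _ i (Finset.mem_filter.2 ⟨Finset.mem_univ _, hmem⟩))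
          (not_le.2 hi)
    have hnot : ¬ (p.1 ∈ D1 j ∨ p.1 ∈ D2 j) := fun h => hcD j ⟨h, hj, hjmin⟩
    rw [not_or] at hnot
    have hz : (d : ℝ) / 4 ≤ ∑ k, (p.1 j k) ^ 2 := not_lt.1 hnot.1
    have hg : ∑ i : Fin m, (dot (p.1 (j.succAbove i)) (p.1 j)) ^ 4 ≤
        MM * N * (∑ k, (p.1 j k) ^ 2) ^ 2 := by
      by_contra h
      exact hnot.2 ⟨by linarith, not_le.1 h⟩
    obtain ⟨δ, h1, h2, h3⟩ := det_part m d γ hd hm hγ' hγ1 p.1 p.2 j hj hz hg hY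
    refine ⟨δ, h1, h2, h3.trans ?_⟩
    linarith
  have hNpos : 0 < N := by rw [hN]; positivity
  have hN2 : 2 ≤ N := by rw [hN]; exact_mod_cast hn
  have hlog : 0 < Real.log N := Real.log_pos (by linarith)
  have hAm : G A ≤ ENNReal.ofReal (VV / N) :=
    cheb_aux (gaussianReal 0 1) _ memLp_pow4 E4_nonneg (m + 1) (m + 1) le_rfl (Nat.succ_pos m)
  have hBm : G B ≤ ENNReal.ofReal (12 * Real.exp (-(1/2) * Real.log N)) := none_prob (m + 1) hn
  have hDm : ∀ j, sample (m + 1) d (D1 j ∪ D2 j) ≤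
      ENNReal.ofReal (Real.exp (-(1/16) * d) + VV / N) := by
    intro j
    rw [ENNReal.ofReal_add (by positivity) (by positivity)]
    refine (measure_union_le _ _).trans (add_le_add ?_ (g_bad m d j))
    have hmp := measurePreserving_eval (fun _ : Fin (m + 1) => _root_.stdGaussian d) j
    have hms : MeasurableSet {v : Fin d → ℝ | ∑ k, (v k) ^ 2 < (d : ℝ) / 4} :=
      measurableSet_lt (by fun_prop) (by fun_prop)
    have := hmp.measure_preimage hms.nullMeasurableSet
    exact this.le.trans (norm_tail d)
  have hKm : ∀ j, MeasurableSet (K j) := by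
    intro j
    have : K j = (fun y => y j) ⁻¹' (Set.Icc r (2 * r)) ∩
        ⋂ i, ⋂ (_ : i < j), (fun y => y i) ⁻¹' (Set.Icc r (2 * r))ᶜ := by
      ext y; simp [hK]
    rw [this]
    refine MeasurableSet.inter (measurable_pi_apply j measurableSet_Icc) ?_
    refine MeasurableSet.iInter fun i => MeasurableSet.iInter fun _ => ?_
    exact measurable_pi_apply i measurableSet_Icc.compl
  have hKd : Pairwise (Function.onFun Disjoint K) := by
    intro i j hij
    rw [Function.onFun, Set.disjoint_left]
    rintro y ⟨h1, h2⟩ ⟨h3, h4⟩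
    rcases lt_or_gt_of_ne hij with h | h
    · exact h4 i h h1
    · exact h2 j h h3
  have hKsum : ∑ j, G (K j) ≤ 1 := by
    rw [← tsum_fintype (L := SummationFilter.unconditional _), ← measure_iUnion hKd hKm]
    exact prob_le_one
  have hbad : samplePairs (m + 1) d Sᶜ ≤ ENNReal.ofReal (VV / N) +
      ENNReal.ofReal (12 * Real.exp (-(1/2) * Real.log N)) +
      ENNReal.ofReal (Real.exp (-(1/16) * d) + VV / N) := by
    refine (measure_mono hcover).trans ((measure_union_le _ _).trans (add_le_add
      ((measure_union_le _ _).trans (add_le_add ?_ ?_)) ?_))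
    · unfold samplePairs; rw [Measure.prod_prod, measure_univ, one_mul]; exact hAm
    · unfold samplePairs; rw [Measure.prod_prod, measure_univ, one_mul]; exact hBm
    · refine (measure_iUnion_fintype_le _ _).trans ?_
      unfold samplePairs
      simp only [Measure.prod_prod]
      calc _ ≤ ∑ j, ENNReal.ofReal (Real.exp (-(1/16) * d) + VV / N) * G (K j) :=
            Finset.sum_le_sum fun j _ => mul_le_mul_left (hDm j) _
        _ ≤ _ := by
            rw [← Finset.mul_sum]
            exact mul_le_of_le_one_right zero_le hKsum
  rw [← ENNReal.ofReal_add (by positivity) (by positivity),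
    ← ENNReal.ofReal_add (by positivity) (by positivity)] at hbad
  have hbad' := ENNReal.toReal_le_of_le_ofReal (by positivity) hbad
  have hone : 1 ≤ (samplePairs (m + 1) d S).toReal + (samplePairs (m + 1) d Sᶜ).toReal := by
    rw [← ENNReal.toReal_add (measure_ne_top _ _) (measure_ne_top _ _)]
    have h1 : (1 : ENNReal) ≤ samplePairs (m + 1) d S + samplePairs (m + 1) d Sᶜ := by
      rw [← measure_univ (μ := samplePairs (m + 1) d), ← Set.union_compl_self S]
      exact measure_union_le _ _
    have h2 := ENNReal.toReal_mono (by finiteness) h1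
    simpa using h2
  have he1 : Real.exp (-(1/16) * d) ≤ Real.exp (-(1/16) * √d) := by
    rw [Real.exp_le_exp]
    have h1 : (1:ℝ) ≤ d := by exact_mod_cast hd
    have h2 : √(d:ℝ) ≤ d := by
      rw [Real.sqrt_le_left hdpos.le]; nlinarith
    linarith
  have he2 : Real.exp (-(1/2) * Real.log N) ≤ Real.exp (-(1/16) * Real.log N) := by
    rw [Real.exp_le_exp]; linarith
  have he3 : VV / N ≤ VV * Real.exp (-(1/16) * Real.log N) := by
    rw [div_eq_mul_inv]
    refine mul_le_mul_of_nonneg_left ?_ hV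
    rw [← Real.exp_log hNpos, ← Real.exp_neg, Real.log_exp, Real.exp_le_exp]
    linarith
  have hp1 := Real.exp_pos (-(1/16) * √(d:ℝ))
  have hp2 := Real.exp_pos (-(1/16) * Real.log N)
  have hf1 : Real.exp (-(1/16) * √(d:ℝ)) ≤ C * Real.exp (-(1/16) * √(d:ℝ)) := by nlinarith
  have hf2 : (12 + 2 * VV) * Real.exp (-(1/16) * Real.log N) ≤
      C * Real.exp (-(1/16) * Real.log N) :=
    mul_le_mul_of_nonneg_right (by linarith) hp2.le
  linarith
end
end
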